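/- arXiv:2110.13193 — 3 statements merged into one kernel-verified Lean document; each statement's English description precedes it below -/
import Mathlib

section
/- For a differentiable family of positive definite density matrices ρ_t on [0,T], the evolution time satisfies T ≥ |S(ρ_T) − S(ρ_0)| / (Λ · L), where Λ = sqrt((1/T)∫₀ᵀ ‖ρ̇_t‖²_HS dt) and L = sqrt((1/T)∫₀ᵀ ‖ln ρ_t‖²_HS dt), assuming Λ·L > 0. -/
noncomputable section

open Matrix MeasureTheory
open scoped ComplexOrder

def matLog {n : Type*} [Fintype n] [DecidableEq n] (A : Matrix n n ℂ) : Matrix n n ℂ :=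
  cfc Real.log A

def hsNorm {n : Type*} [Fintype n] (A : Matrix n n ℂ) : ℝ :=
  Real.sqrt (Matrix.trace (Aᴴ * A)).re

def trNorm {n : Type*} [Fintype n] [DecidableEq n] (A : Matrix n n ℂ) : ℝ :=
  (Matrix.trace (cfc Real.sqrt (Aᴴ * A))).re

def opNorm {n : Type*} [Fintype n] [DecidableEq n] {A : Matrix n n ℂ}
    (hA : A.IsHermitian) : ℝ :=
  ⨆ i, |hA.eigenvalues i|

def vnEntropy {n : Type*} [Fintype n] [DecidableEq n] (ρ : Matrix n n ℂ) : ℝ :=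
  -(Matrix.trace (ρ * matLog ρ)).re

def maxInfo {n : Type*} [Fintype n] [DecidableEq n] (ρ : Matrix n n ℂ) : ℝ :=
  Real.log (Fintype.card n) - vnEntropy ρ

def deph {n : Type*} [DecidableEq n] (A : Matrix n n ℂ) : Matrix n n ℂ :=
  Matrix.diagonal (fun i => A i i)

def relEntCoh {n : Type*} [Fintype n] [DecidableEq n] (ρ : Matrix n n ℂ) : ℝ :=
  vnEntropy (deph ρ) - vnEntropy ρ


namespace Matrix

variable {n : Type*} [Fintype n]

lemma hsNorm_sq_eq_sum (A : Matrix n n ℂ) : hsNorm A ^ 2 = ∑ p : n × n, ‖A p.1 p.2‖ ^ 2 := by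
  have h : (trace (Aᴴ * A)).re = ∑ p : n × n, ‖A p.1 p.2‖ ^ 2 := by
    rw [Fintype.sum_prod_type_right]
    simp only [trace, diag_apply, mul_apply, conjTranspose_apply, Complex.re_sum]
    refine Finset.sum_congr rfl fun i _ => Finset.sum_congr rfl fun j _ => ?_
    rw [RCLike.star_def, Complex.conj_mul', ← Complex.ofReal_pow, Complex.ofReal_re]
  rw [hsNorm, h, Real.sq_sqrt (by positivity)]

lemma abs_re_trace_conjTranspose_mul_le (A B : Matrix n n ℂ) :
    |(trace (Aᴴ * B)).re| ≤ hsNorm A * hsNorm B := by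
  have h : trace (Aᴴ * B) = ∑ p : n × n, star (A p.1 p.2) * B p.1 p.2 := by
    rw [Fintype.sum_prod_type_right]
    simp only [trace, diag_apply, mul_apply, conjTranspose_apply]
  calc |(trace (Aᴴ * B)).re| ≤ ‖trace (Aᴴ * B)‖ := Complex.abs_re_le_norm _
    _ ≤ ∑ p : n × n, ‖A p.1 p.2‖ * ‖B p.1 p.2‖ := by
      rw [h]
      exact (norm_sum_le _ _).trans_eq (by simp)
    _ ≤ √(∑ p : n × n, ‖A p.1 p.2‖ ^ 2) * √(∑ p : n × n, ‖B p.1 p.2‖ ^ 2) :=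
      Real.sum_mul_le_sqrt_mul_sqrt _ _ _
    _ = hsNorm A * hsNorm B := by
      rw [← hsNorm_sq_eq_sum, ← hsNorm_sq_eq_sum, Real.sqrt_sq (show 0 ≤ hsNorm A from Real.sqrt_nonneg _),
        Real.sqrt_sq (show 0 ≤ hsNorm B from Real.sqrt_nonneg _)]

variable [DecidableEq n]

lemma IsHermitian.re_trace_cfc_mul_cfc {A B : Matrix n n ℂ} (hA : A.IsHermitian)
    (hB : B.IsHermitian) (f g : ℝ → ℝ) :
    (trace (cfc f A * cfc g B)).re = ∑ i, ∑ j, f (hA.eigenvalues i) * g (hB.eigenvalues j) *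
      Complex.normSq ((star (hA.eigenvectorUnitary : Matrix n n ℂ) *
        (hB.eigenvectorUnitary : Matrix n n ℂ)) i j) := by
  set U : Matrix n n ℂ := (hA.eigenvectorUnitary : Matrix n n ℂ)
  set V : Matrix n n ℂ := (hB.eigenvectorUnitary : Matrix n n ℂ)
  set W := star U * V with hW
  have hWs : star V * U = star W := by simp [hW]
  have h : trace (cfc f A * cfc g B) =
      trace (diagonal (RCLike.ofReal ∘ f ∘ hA.eigenvalues) *
        (W * diagonal (RCLike.ofReal ∘ g ∘ hB.eigenvalues) * star W)) := by
    rw [hA.cfc_eq, hB.cfc_eq, IsHermitian.cfc, IsHermitian.cfc, Unitary.conjStarAlgAut_apply,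
      Unitary.conjStarAlgAut_apply, ← hWs, hW]
    simp only [Matrix.mul_assoc]
    rw [trace_mul_comm]
    simp only [Matrix.mul_assoc]
    rfl
  rw [h]
  clear_value W
  simp only [trace, diag_apply, diagonal_mul, Complex.re_sum]
  refine Finset.sum_congr rfl fun i _ => ?_
  rw [mul_apply, Finset.mul_sum, Complex.re_sum]
  refine Finset.sum_congr rfl fun j _ => ?_
  rw [mul_diagonal, star_apply]
  have : (W i j) * star (W i j) = (Complex.normSq (W i j) : ℂ) := Complex.mul_conj _
  rw [mul_right_comm (W i j), this]
  simp
  ring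

/-- **Klein's inequality** for positive definite matrices. -/
lemma PosDef.trace_sub_trace_le {A B : Matrix n n ℂ} (hA : A.PosDef) (hB : B.PosDef) :
    (trace A).re - (trace B).re ≤
      (trace (A * matLog A)).re - (trace (A * matLog B)).re := by
  have hAs : IsSelfAdjoint A := hA.1
  have hBs : IsSelfAdjoint B := hB.1
  have key := hA.1.re_trace_cfc_mul_cfc hB.1
  have h1 := key id (fun _ => 1)
  have h2 := key (fun _ => 1) id
  have h3 := key id Real.log
  have h4 := key (fun x => id x * Real.log x) (fun _ => 1)
  rw [cfc_mul id Real.log A (A.finite_real_spectrum.continuousOn _)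
    (A.finite_real_spectrum.continuousOn _), cfc_id ℝ A, cfc_const_one ℝ B, Matrix.mul_one] at h4
  rw [cfc_id ℝ A, cfc_const_one ℝ B, Matrix.mul_one] at h1
  rw [cfc_id ℝ B, cfc_const_one ℝ A, Matrix.one_mul] at h2
  rw [cfc_id ℝ A] at h3
  rw [matLog, matLog, h1, h2, h3, h4]
  simp only [← Finset.sum_sub_distrib]
  refine Finset.sum_le_sum fun i _ => Finset.sum_le_sum fun j _ => ?_
  simp only [← sub_mul, id]
  refine mul_le_mul_of_nonneg_right ?_ (Complex.normSq_nonneg _)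
  have ha := hA.eigenvalues_pos i
  have hb := hB.eigenvalues_pos j
  set a := hA.1.eigenvalues i
  set b := hB.1.eigenvalues j
  have h := mul_le_mul_of_nonneg_left (Real.log_le_sub_one_of_pos (div_pos hb ha)) ha.le
  rw [Real.log_div hb.ne' ha.ne', mul_sub, mul_sub, mul_div_cancel₀ _ ha.ne'] at h
  linarith

open scoped Matrix.Norms.L2Operator in
lemma continuous_matLog_comp {X : Type*} [TopologicalSpace X] {ρ : X → Matrix n n ℂ}
    (hρ : Continuous ρ) (hpd : ∀ t, (ρ t).PosDef) : Continuous fun t => matLog (ρ t) :=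
  CFC.continuousOn_log.comp_continuous hρ fun t => ⟨(hpd t).1, (hpd t).isUnit⟩

/-- The derivative formula for the von Neumann entropy. -/
lemma hasDerivAt_vnEntropy {ρ : ℝ → Matrix n n ℂ} {R : Matrix n n ℂ} {t : ℝ}
    (hpd : ∀ s, (ρ s).PosDef) (htr : ∀ s, (ρ s).trace = 1)
    (hd : ∀ i j, HasDerivAt (fun s => ρ s i j) (R i j) t)
    (hL : ContinuousAt (fun s => matLog (ρ s)) t) :
    HasDerivAt (fun s => vnEntropy (ρ s)) (-(trace (R * matLog (ρ t))).re) t := by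
  have klein (s u : ℝ) : (trace (ρ s * matLog (ρ u))).re ≤ (trace (ρ s * matLog (ρ s))).re := by
    have := (hpd s).trace_sub_trace_le (hpd u)
    rw [htr, htr] at this
    linarith
  have hlin : HasDerivAt (fun s => (trace (ρ s * matLog (ρ t))).re)
      (trace (R * matLog (ρ t))).re t := by
    have : HasDerivAt (fun s => trace (ρ s * matLog (ρ t))) (trace (R * matLog (ρ t))) t := by
      simp only [trace, diag_apply, mul_apply]
      exact HasDerivAt.fun_sum fun i _ => HasDerivAt.fun_sum fun j _ => (hd i j).mul_const _
    exact (Complex.reCLM.hasFDerivAt.comp_hasDerivAt t this)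
  have hrem : (fun s => trace ((ρ s - ρ t) * (matLog (ρ s) - matLog (ρ t))))
      =o[nhds t] fun s => s - t := by
    simp only [trace, diag_apply, mul_apply]
    refine Asymptotics.IsLittleO.fun_sum fun i _ => Asymptotics.IsLittleO.fun_sum fun j _ => ?_
    have h1 : (fun s => (ρ s - ρ t) i j) =O[nhds t] fun s => s - t := (hd i j).isBigO_sub
    have h2 : (fun s => (matLog (ρ s) - matLog (ρ t)) j i) =o[nhds t] fun _ => (1 : ℝ) := by
      rw [Asymptotics.isLittleO_one_iff]
      have := ((hL.sub continuousAt_const : ContinuousAt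
        (fun s => matLog (ρ s) - matLog (ρ t)) t).tendsto.apply_nhds j).apply_nhds i
      simpa using this
    simpa using h1.mul_isLittleO h2
  suffices h : HasDerivAt (fun s => (trace (ρ s * matLog (ρ s))).re)
      (trace (R * matLog (ρ t))).re t from h.fun_neg
  rw [hasDerivAt_iff_isLittleO] at hlin ⊢
  have hdiff : (fun s => (trace (ρ s * matLog (ρ s))).re - (trace (ρ s * matLog (ρ t))).re)
      =o[nhds t] fun s => s - t := by
    refine (Asymptotics.IsBigO.of_bound' (.of_forall fun s => ?_)).trans_isLittleO hrem
    have h1 := klein s t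
    have h2 := klein t s
    refine le_trans ?_ (Complex.abs_re_le_norm _)
    rw [Real.norm_eq_abs, abs_of_nonneg (by linarith)]
    refine le_trans ?_ (le_abs_self _)
    simp only [Matrix.sub_mul, Matrix.mul_sub, trace_sub, Complex.sub_re]
    linarith
  refine (hlin.add hdiff).congr_left fun s => ?_
  ring

end Matrix

theorem entropy_speed_limit {n : Type*} [Fintype n] [DecidableEq n]
    (ρ ρ' : ℝ → Matrix n n ℂ) (T : ℝ) (hT : 0 < T)
    (hpd : ∀ t, (ρ t).PosDef) (htr : ∀ t, (ρ t).trace = 1)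
    (hd : ∀ t i j, HasDerivAt (fun s => ρ s i j) (ρ' t i j) t)
    (hc : ∀ i j, Continuous fun t => ρ' t i j)
    (hpos : 0 < Real.sqrt ((1 / T) * ∫ t in (0:ℝ)..T, (hsNorm (ρ' t)) ^ 2) *
        Real.sqrt ((1 / T) * ∫ t in (0:ℝ)..T, (hsNorm (matLog (ρ t))) ^ 2)) :
    |vnEntropy (ρ T) - vnEntropy (ρ 0)| /
      (Real.sqrt ((1 / T) * ∫ t in (0:ℝ)..T, (hsNorm (ρ' t)) ^ 2) *
        Real.sqrt ((1 / T) * ∫ t in (0:ℝ)..T, (hsNorm (matLog (ρ t))) ^ 2)) ≤ T := by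
  have hρ : Continuous ρ :=
    continuous_matrix fun i j => continuous_iff_continuousAt.2 fun t => (hd t i j).continuousAt
  have hL : Continuous fun t => matLog (ρ t) := continuous_matLog_comp hρ hpd
  have hρ' : Continuous ρ' := continuous_matrix hc
  have hns {A : ℝ → Matrix n n ℂ} (hA : Continuous A) : Continuous fun t => hsNorm (A t) ^ 2 := by
    simp only [hsNorm_sq_eq_sum]
    exact continuous_finsetSum _ fun p _ => ((hA.matrix_elem p.1 p.2).norm).pow 2
  set a := √((1 / T) * ∫ t in (0:ℝ)..T, (hsNorm (ρ' t)) ^ 2) with ha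
  set b := √((1 / T) * ∫ t in (0:ℝ)..T, (hsNorm (matLog (ρ t))) ^ 2) with hb
  have ha0 : 0 < a := pos_of_mul_pos_left hpos (Real.sqrt_nonneg _)
  have hb0 : 0 < b := pos_of_mul_pos_right hpos (Real.sqrt_nonneg _)
  have ha2 : ∫ t in (0:ℝ)..T, (hsNorm (ρ' t)) ^ 2 = T * a ^ 2 := by
    rw [ha, Real.sq_sqrt (Real.sqrt_pos.1 ha0).le]
    field_simp
  have hb2 : ∫ t in (0:ℝ)..T, (hsNorm (matLog (ρ t))) ^ 2 = T * b ^ 2 := by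
    rw [hb, Real.sq_sqrt (Real.sqrt_pos.1 hb0).le]
    field_simp
  have hderiv (t : ℝ) : HasDerivAt (fun s => vnEntropy (ρ s))
      (-(trace (ρ' t * matLog (ρ t))).re) t :=
    hasDerivAt_vnEntropy hpd htr (hd t) hL.continuousAt
  have hcont : Continuous fun t => -(trace (ρ' t * matLog (ρ t))).re :=
    (Complex.continuous_re.comp (hρ'.matrix_mul hL).matrix_trace).neg
  have hbound (t : ℝ) : ‖-(trace (ρ' t * matLog (ρ t))).re‖ ≤
      b / (2 * a) * hsNorm (ρ' t) ^ 2 + a / (2 * b) * hsNorm (matLog (ρ t)) ^ 2 := by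
    have hsa : (matLog (ρ t))ᴴ = matLog (ρ t) := cfc_predicate Real.log (ρ t)
    have h := abs_re_trace_conjTranspose_mul_le (matLog (ρ t)) (ρ' t)
    rw [hsa, trace_mul_comm] at h
    rw [norm_neg, Real.norm_eq_abs]
    refine h.trans ?_
    set x := hsNorm (ρ' t)
    set y := hsNorm (matLog (ρ t))
    have : b / (2 * a) * x ^ 2 + a / (2 * b) * y ^ 2 - y * x =
        (b * x - a * y) ^ 2 / (2 * a * b) := by
      field_simp
      ring
    have : 0 ≤ (b * x - a * y) ^ 2 / (2 * a * b) := by positivity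
    linarith
  rw [div_le_iff₀ hpos, ← intervalIntegral.integral_eq_sub_of_hasDerivAt
    (fun t _ => hderiv t) (hcont.intervalIntegrable _ _)]
  have hi1 := ((hns hρ').const_mul (b / (2 * a))).intervalIntegrable (μ := volume) 0 T
  have hi2 := ((hns hL).const_mul (a / (2 * b))).intervalIntegrable (μ := volume) 0 T
  refine (intervalIntegral.norm_integral_le_of_norm_le hT.le
    (.of_forall fun t _ => hbound t) (hi1.add hi2)).trans_eq ?_
  rw [intervalIntegral.integral_add hi1 hi2, intervalIntegral.integral_const_mul,
    intervalIntegral.integral_const_mul, ha2, hb2]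
  field_simp
  ring
end
end

section
/- For a differentiable family of positive definite density matrices ρ_t on [0,T], T ≥ |C(ρ_T) − C(ρ_0)| / (Λ^D·L^D + Λ·L), where Λ^D = sqrt((1/T)∫₀ᵀ‖ρ̇_t^D‖²_HS dt), L^D = sqrt((1/T)∫₀ᵀ‖ln ρ_t^D‖²_HS dt), Λ = sqrt((1/T)∫₀ᵀ‖ρ̇_t‖²_HS dt), L = sqrt((1/T)∫₀ᵀ‖ln ρ_t‖²_HS dt), assuming the denominator is positive. -/
noncomputable section

open Matrix MeasureTheory
open scoped ComplexOrder

open scoped Matrix.Norms.L2Operator in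
theorem continuous_matLog {n : Type*} [Fintype n] [DecidableEq n] {ρ : ℝ → Matrix n n ℂ}
    (hpd : ∀ t, (ρ t).PosDef) (hc : Continuous ρ) : Continuous fun t => matLog (ρ t) :=
  (CFC.continuousOn_log (A := Matrix n n ℂ)).comp_continuous hc
    fun t => ⟨(hpd t).isHermitian.isSelfAdjoint, (hpd t).isUnit⟩

theorem trace_cfc_mul_cfc {n : Type*} [Fintype n] [DecidableEq n] {A B : Matrix n n ℂ}
    (hA : A.IsHermitian) (hB : B.IsHermitian) :
    ∃ w : n → n → ℝ, (∀ i j, 0 ≤ w i j) ∧ ∀ f g : ℝ → ℝ,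
      (cfc f A * cfc g B).trace.re =
        ∑ i, ∑ j, w i j * (f (hA.eigenvalues i) * g (hB.eigenvalues j)) := by
  set U : Matrix n n ℂ := ↑hA.eigenvectorUnitary with hU
  set V : Matrix n n ℂ := ↑hB.eigenvectorUnitary with hV
  refine ⟨fun i j => Complex.normSq ((Uᴴ * V) i j), fun i j => Complex.normSq_nonneg _,
    fun f g => ?_⟩
  rw [hA.cfc_eq, hB.cfc_eq, IsHermitian.cfc, IsHermitian.cfc,
    Unitary.conjStarAlgAut_apply, Unitary.conjStarAlgAut_apply, ← hU, ← hV]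
  simp only [star_eq_conjTranspose]
  set D := diagonal (RCLike.ofReal ∘ f ∘ hA.eigenvalues : n → ℂ) with hD
  set E := diagonal (RCLike.ofReal ∘ g ∘ hB.eigenvalues : n → ℂ) with hE
  have : (U * D * Uᴴ * (V * E * Vᴴ)).trace = (D * (Uᴴ * V) * E * (Uᴴ * V)ᴴ).trace := by
    rw [show U * D * Uᴴ * (V * E * Vᴴ) = U * (D * Uᴴ * (V * E * Vᴴ)) by
      simp only [Matrix.mul_assoc], Matrix.trace_mul_comm]
    simp only [conjTranspose_mul, conjTranspose_conjTranspose, Matrix.mul_assoc]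
  rw [this, Matrix.trace, Complex.re_sum]
  refine Finset.sum_congr rfl fun i _ => ?_
  rw [Matrix.diag_apply, Matrix.mul_apply, Complex.re_sum]
  refine Finset.sum_congr rfl fun j _ => ?_
  rw [hD, hE, mul_diagonal, diagonal_mul, conjTranspose_apply, Complex.normSq_apply]
  simp
  ring

theorem relative_entropy_nonneg {n : Type*} [Fintype n] [DecidableEq n] {A B : Matrix n n ℂ}
    (hA : A.PosDef) (hB : B.PosDef) (htr : A.trace = B.trace) :
    (matLog A * B).trace.re ≤ (matLog B * B).trace.re := by
  obtain ⟨w, hw, h⟩ := trace_cfc_mul_cfc hA.isHermitian hB.isHermitian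
  have hAid := cfc_id' ℝ A hA.isHermitian.isSelfAdjoint
  have hBid := cfc_id' ℝ B hB.isHermitian.isSelfAdjoint
  have hAone := cfc_const_one ℝ A hA.isHermitian.isSelfAdjoint
  have hBone := cfc_const_one ℝ B hB.isHermitian.isSelfAdjoint
  have hBmul : cfc (fun x => Real.log x * x) B = matLog B * B := by
    rw [cfc_mul Real.log (fun x => x) B
      (by rw [continuousOn_iff_continuous_domRestrict]; fun_prop), hBid, matLog]
  have hlog := h Real.log (fun x => x)
  have hAt := h (fun x => x) (fun _ => 1)
  have hBt := h (fun _ => 1) (fun x => x)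
  have hent := h (fun _ => 1) (fun x => Real.log x * x)
  rw [hBid, ← matLog] at hlog
  rw [hAid, hBone, mul_one] at hAt
  rw [hAone, hBid, one_mul] at hBt
  rw [hAone, hBmul, one_mul] at hent
  have key : (matLog A * B).trace.re + B.trace.re ≤ (matLog B * B).trace.re + A.trace.re := by
    rw [hlog, hBt, hAt, hent]
    simp only [← Finset.sum_add_distrib, ← mul_add]
    refine Finset.sum_le_sum fun i _ => Finset.sum_le_sum fun j _ =>
      mul_le_mul_of_nonneg_left ?_ (hw i j)
    have ha := hA.eigenvalues_pos i
    have hb := hB.eigenvalues_pos j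
    have := Real.log_le_sub_one_of_pos (div_pos ha hb)
    rw [Real.log_div ha.ne' hb.ne'] at this
    have := mul_le_mul_of_nonneg_right this hb.le
    rw [sub_mul _ 1, div_mul_cancel₀ _ hb.ne'] at this
    linarith
  rw [htr] at key
  linarith

theorem hasDerivAt_mul_of_eq_zero {f g : ℝ → ℂ} {g' : ℂ} {t : ℝ} (hf : ContinuousAt f t)
    (hf0 : f t = 0) (hg : HasDerivAt g g' t) (hg0 : g t = 0) :
    HasDerivAt (fun s => f s * g s) 0 t := by
  rw [hasDerivAt_iff_isLittleO]
  have h1 : (fun s => g s) =O[nhds t] fun s => s - t := by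
    simpa [hg0] using hg.isBigO_sub
  have h2 : f =o[nhds t] fun _ => (1:ℝ) := by
    rw [Asymptotics.isLittleO_one_iff]
    simpa [hf0] using hf.tendsto
  simpa [hf0] using h2.mul_isBigO h1

theorem hasDerivAt_vnEntropy {n : Type*} [Fintype n] [DecidableEq n] {ρ ρ' : ℝ → Matrix n n ℂ}
    (hpd : ∀ t, (ρ t).PosDef) (htr : ∀ t, (ρ t).trace = 1)
    (hd : ∀ t i j, HasDerivAt (fun s => ρ s i j) (ρ' t i j) t)
    (hlog : Continuous fun t => matLog (ρ t)) (t : ℝ) :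
    HasDerivAt (fun s => vnEntropy (ρ s)) (-(matLog (ρ t) * ρ' t).trace.re) t := by
  let F : ℝ → ℝ := fun s => (matLog (ρ s) * ρ s).trace.re
  let R : ℝ → ℝ := fun s => (matLog (ρ t) * (ρ s - ρ t)).trace.re
  let E : ℝ → ℝ := fun s => ((matLog (ρ s) - matLog (ρ t)) * (ρ s - ρ t)).trace.re
  have hR : HasDerivAt R (matLog (ρ t) * ρ' t).trace.re t := by
    have : HasDerivAt (fun s => (matLog (ρ t) * (ρ s - ρ t)).trace)
        (matLog (ρ t) * ρ' t).trace t := by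
      simp only [Matrix.trace, Matrix.diag_apply, Matrix.mul_apply, Matrix.sub_apply]
      exact HasDerivAt.fun_sum fun i _ => HasDerivAt.fun_sum fun j _ =>
        ((hd t j i).sub_const _).const_mul _
    exact Complex.reCLM.hasFDerivAt.comp_hasDerivAt t this
  have hE : HasDerivAt E 0 t := by
    have : HasDerivAt (fun s => ((matLog (ρ s) - matLog (ρ t)) * (ρ s - ρ t)).trace) 0 t := by
      simp only [Matrix.trace, Matrix.diag_apply, Matrix.mul_apply, Matrix.sub_apply]
      rw [show (0:ℂ) = ∑ i : n, ∑ j : n, 0 by simp]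
      refine HasDerivAt.fun_sum fun i _ => HasDerivAt.fun_sum fun j _ =>
        hasDerivAt_mul_of_eq_zero ?_ (sub_self _) ((hd t j i).sub_const _) (sub_self _)
      exact ((hlog.matrix_elem i j).sub continuous_const).continuousAt
    exact Complex.reCLM.hasFDerivAt.comp_hasDerivAt t this
  have hlow : ∀ s, 0 ≤ F s - F t - R s := fun s => by
    have := relative_entropy_nonneg (hpd t) (hpd s) (by rw [htr, htr])
    simp only [F, R, Matrix.mul_sub, Matrix.trace_sub, Complex.sub_re]
    linarith
  have hup : ∀ s, F s - F t - R s ≤ E s := fun s => by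
    have := relative_entropy_nonneg (hpd s) (hpd t) (by rw [htr, htr])
    simp only [F, R, E, Matrix.mul_sub, Matrix.sub_mul, Matrix.trace_sub, Complex.sub_re]
    linarith
  have hG : HasDerivAt (fun s => F s - F t - R s) 0 t := by
    rw [hasDerivAt_iff_isLittleO] at hE ⊢
    refine Asymptotics.IsBigO.trans_isLittleO (Asymptotics.IsBigO.of_bound 1 ?_) hE
    refine Filter.Eventually.of_forall fun s => ?_
    have h1 := hlow s
    have h2 := hup s
    have hEt : E t = 0 := by simp [E]
    have hRt : R t = 0 := by simp [R]
    simp only [hEt, hRt, sub_self, smul_zero, sub_zero, one_mul, Real.norm_eq_abs]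
    rwa [abs_of_nonneg h1, abs_of_nonneg (h1.trans h2)]
  have hfun : (fun s => vnEntropy (ρ s)) = fun s => -((F s - F t - R s) + R s + F t) := by
    funext s
    simp only [vnEntropy, F]
    rw [Matrix.trace_mul_comm]
    ring
  rw [hfun]
  have := ((hG.add hR).add_const (F t)).fun_neg
  rwa [zero_add] at this

theorem hsNorm_sq {n : Type*} [Fintype n] (A : Matrix n n ℂ) :
    hsNorm A ^ 2 = ∑ p : n × n, ‖A p.1 p.2‖ ^ 2 := by
  have : (Aᴴ * A).trace.re = ∑ p : n × n, ‖A p.1 p.2‖ ^ 2 := by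
    rw [Fintype.sum_prod_type_right, Matrix.trace, Complex.re_sum]
    refine Finset.sum_congr rfl fun i _ => ?_
    rw [Matrix.diag_apply, Matrix.mul_apply, Complex.re_sum]
    refine Finset.sum_congr rfl fun j _ => ?_
    rw [conjTranspose_apply, ← Complex.normSq_eq_norm_sq, Complex.normSq_apply]
    simp
  rw [hsNorm, this, Real.sq_sqrt (Finset.sum_nonneg fun p _ => sq_nonneg _)]

theorem abs_re_trace_mul_le {n : Type*} [Fintype n] (A B : Matrix n n ℂ) :
    |(A * B).trace.re| ≤ hsNorm B * hsNorm A := by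
  have h : ∀ C : Matrix n n ℂ, hsNorm C = Real.sqrt (∑ p : n × n, ‖C p.1 p.2‖ ^ 2) := fun C => by
    rw [← hsNorm_sq, Real.sqrt_sq (show 0 ≤ hsNorm C from Real.sqrt_nonneg _)]
  have hA : ∑ p : n × n, ‖A p.1 p.2‖ ^ 2 = ∑ p : n × n, ‖A p.2 p.1‖ ^ 2 := by
    rw [Fintype.sum_prod_type, Fintype.sum_prod_type_right]
  calc |(A * B).trace.re| ≤ ‖(A * B).trace‖ := Complex.abs_re_le_norm _
    _ = ‖∑ p : n × n, A p.2 p.1 * B p.1 p.2‖ := by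
      rw [Fintype.sum_prod_type_right]
      rfl
    _ ≤ ∑ p : n × n, ‖B p.1 p.2‖ * ‖A p.2 p.1‖ :=
      norm_sum_le_of_le _ fun p _ => by rw [norm_mul, mul_comm]
    _ ≤ _ := by
      rw [h, h, hA]
      exact Real.sum_mul_le_sqrt_mul_sqrt _ _ _

theorem integral_mul_le_of_continuous {f g : ℝ → ℝ} (hf : Continuous f) (hg : Continuous g)
    (hf0 : ∀ t, 0 ≤ f t) (hg0 : ∀ t, 0 ≤ g t) {T : ℝ} (hT : 0 < T) :
    ∫ t in (0:ℝ)..T, f t * g t ≤ T * (Real.sqrt ((1 / T) * ∫ t in (0:ℝ)..T, f t ^ 2) *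
      Real.sqrt ((1 / T) * ∫ t in (0:ℝ)..T, g t ^ 2)) := by
  have hmem : ∀ h : ℝ → ℝ, Continuous h →
      MemLp h (ENNReal.ofReal 2) (volume.restrict (Set.Ioc 0 T)) := fun h hh => by
    rw [ENNReal.ofReal_ofNat, memLp_two_iff_integrable_sq hh.aestronglyMeasurable]
    exact ((hh.pow 2).integrableOn_Icc (a := 0) (b := T)).mono_set Set.Ioc_subset_Icc_self
  have := integral_mul_le_Lp_mul_Lq_of_nonneg (μ := volume.restrict (Set.Ioc 0 T))
    Real.HolderConjugate.two_two (.of_forall hf0) (.of_forall hg0) (hmem f hf) (hmem g hg)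
  simp only [Real.rpow_two, ← Real.sqrt_eq_rpow, ← intervalIntegral.integral_of_le hT.le] at this
  rw [Real.sqrt_mul (by positivity), Real.sqrt_mul (by positivity), mul_mul_mul_comm,
    Real.mul_self_sqrt (by positivity), ← mul_assoc, mul_one_div_cancel hT.ne', one_mul]
  exact this

theorem abs_vnEntropy_sub_le {n : Type*} [Fintype n] [DecidableEq n] {ρ ρ' : ℝ → Matrix n n ℂ}
    {T : ℝ} (hT : 0 < T) (hpd : ∀ t, (ρ t).PosDef) (htr : ∀ t, (ρ t).trace = 1)
    (hd : ∀ t i j, HasDerivAt (fun s => ρ s i j) (ρ' t i j) t)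
    (hc : ∀ i j, Continuous fun t => ρ' t i j) :
    |vnEntropy (ρ T) - vnEntropy (ρ 0)| ≤
      T * (Real.sqrt ((1 / T) * ∫ t in (0:ℝ)..T, (hsNorm (ρ' t)) ^ 2) *
          Real.sqrt ((1 / T) * ∫ t in (0:ℝ)..T, (hsNorm (matLog (ρ t))) ^ 2)) := by
  have hρ : Continuous ρ := continuous_matrix fun i j =>
    continuous_iff_continuousAt.2 fun t => (hd t i j).continuousAt
  have hρ' : Continuous ρ' := continuous_matrix hc
  have hlog := continuous_matLog hpd hρ
  have hns : Continuous (hsNorm : Matrix n n ℂ → ℝ) := by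
    unfold hsNorm
    fun_prop
  have hcont : Continuous fun t => -(matLog (ρ t) * ρ' t).trace.re := by fun_prop
  rw [← intervalIntegral.integral_eq_sub_of_hasDerivAt
    (fun t _ => hasDerivAt_vnEntropy hpd htr hd hlog t) (hcont.intervalIntegrable _ _)]
  have hi : Continuous fun t => hsNorm (ρ' t) * hsNorm (matLog (ρ t)) :=
    (hns.comp hρ').mul (hns.comp hlog)
  refine le_trans ?_ (integral_mul_le_of_continuous (hns.comp hρ') (hns.comp hlog)
    (fun _ => Real.sqrt_nonneg _) (fun _ => Real.sqrt_nonneg _) hT)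
  refine (intervalIntegral.abs_integral_le_integral_abs hT.le).trans ?_
  refine intervalIntegral.integral_mono_on hT.le (hcont.abs.intervalIntegrable _ _)
    (hi.intervalIntegrable _ _) fun t _ => ?_
  rw [abs_neg]
  exact abs_re_trace_mul_le _ _

theorem coherence_speed_limit {n : Type*} [Fintype n] [DecidableEq n]
    (ρ ρ' : ℝ → Matrix n n ℂ) (T : ℝ) (hT : 0 < T)
    (hpd : ∀ t, (ρ t).PosDef) (hpdD : ∀ t, (deph (ρ t)).PosDef)
    (htr : ∀ t, (ρ t).trace = 1)
    (hd : ∀ t i j, HasDerivAt (fun s => ρ s i j) (ρ' t i j) t)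
    (hc : ∀ i j, Continuous fun t => ρ' t i j)
    (hpos : 0 <
      Real.sqrt ((1 / T) * ∫ t in (0:ℝ)..T, (hsNorm (deph (ρ' t))) ^ 2) *
          Real.sqrt ((1 / T) * ∫ t in (0:ℝ)..T, (hsNorm (matLog (deph (ρ t)))) ^ 2) +
        Real.sqrt ((1 / T) * ∫ t in (0:ℝ)..T, (hsNorm (ρ' t)) ^ 2) *
          Real.sqrt ((1 / T) * ∫ t in (0:ℝ)..T, (hsNorm (matLog (ρ t))) ^ 2)) :
    |relEntCoh (ρ T) - relEntCoh (ρ 0)| /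
      (Real.sqrt ((1 / T) * ∫ t in (0:ℝ)..T, (hsNorm (deph (ρ' t))) ^ 2) *
          Real.sqrt ((1 / T) * ∫ t in (0:ℝ)..T, (hsNorm (matLog (deph (ρ t)))) ^ 2) +
        Real.sqrt ((1 / T) * ∫ t in (0:ℝ)..T, (hsNorm (ρ' t)) ^ 2) *
          Real.sqrt ((1 / T) * ∫ t in (0:ℝ)..T, (hsNorm (matLog (ρ t))) ^ 2)) ≤ T := by
  have hdeph : ∀ A : Matrix n n ℂ, (deph A).trace = A.trace := fun A => by
    simp [deph, Matrix.trace]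
  have h1 := abs_vnEntropy_sub_le hT hpd htr hd hc
  have h2 := abs_vnEntropy_sub_le (ρ := fun t => deph (ρ t)) (ρ' := fun t => deph (ρ' t)) hT hpdD
    (fun t => (hdeph _).trans (htr t))
    (fun t i j => by
      rcases eq_or_ne i j with rfl | hij
      · simpa [deph] using hd t i i
      · simpa [deph, diagonal_apply_ne _ hij] using hasDerivAt_const t (0:ℂ))
    (fun i j => by
      rcases eq_or_ne i j with rfl | hij
      · simpa [deph] using hc i i
      · simpa [deph, diagonal_apply_ne _ hij] using continuous_const)
  rw [div_le_iff₀ hpos, mul_add]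
  refine le_trans ?_ (add_le_add h2 h1)
  rw [relEntCoh, relEntCoh, sub_sub_sub_comm]
  exact abs_sub _ _
end
end

section
/- For a differentiable family of positive definite density matrices ρ_t on [0,T] in dimension d, T ≥ |I(ρ_T) − I(ρ_0)|² / ∫₀ᵀ (‖ρ̇_t‖_tr · ‖ln ρ_t‖_op)² dt, where I(ρ) = ln d − S(ρ), assuming the integral is positive. -/
noncomputable section

open Matrix MeasureTheory
open scoped ComplexOrder

namespace Matrix

variable {n : Type*} [Fintype n] [DecidableEq n]

theorem IsHermitian.cfc_eq_mul_diagonal_mul {A : Matrix n n ℂ} (hA : A.IsHermitian) (f : ℝ → ℝ) :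
    cfc f A = (hA.eigenvectorUnitary : Matrix n n ℂ) *
      diagonal (fun i => (f (hA.eigenvalues i) : ℂ)) *
        (hA.eigenvectorUnitary : Matrix n n ℂ)ᴴ := by
  rw [hA.cfc_eq, IsHermitian.cfc, Unitary.conjStarAlgAut_apply]
  rfl

theorem IsHermitian.eq_mul_diagonal_mul {A : Matrix n n ℂ} (hA : A.IsHermitian) :
    A = (hA.eigenvectorUnitary : Matrix n n ℂ) *
      diagonal (fun i => (hA.eigenvalues i : ℂ)) *
        (hA.eigenvectorUnitary : Matrix n n ℂ)ᴴ := by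
  conv_lhs => rw [hA.spectral_theorem, Unitary.conjStarAlgAut_apply]
  rfl

theorem IsHermitian.conjTranspose_eigenvectorUnitary_mul {A : Matrix n n ℂ}
    (hA : A.IsHermitian) :
    (hA.eigenvectorUnitary : Matrix n n ℂ)ᴴ * (hA.eigenvectorUnitary : Matrix n n ℂ) = 1 :=
  Unitary.coe_star_mul_self hA.eigenvectorUnitary

theorem IsHermitian.eigenvectorUnitary_mul_conjTranspose {A : Matrix n n ℂ}
    (hA : A.IsHermitian) :
    (hA.eigenvectorUnitary : Matrix n n ℂ) * (hA.eigenvectorUnitary : Matrix n n ℂ)ᴴ = 1 :=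
  Unitary.coe_mul_star_self hA.eigenvectorUnitary

theorem IsHermitian.trace_cfc_mul_cfc {A B : Matrix n n ℂ} (hA : A.IsHermitian)
    (hB : B.IsHermitian) (f g : ℝ → ℝ) :
    (trace (cfc f B * cfc g A)).re = ∑ j, ∑ i, f (hB.eigenvalues j) * g (hA.eigenvalues i) *
      Complex.normSq (((hB.eigenvectorUnitary : Matrix n n ℂ)ᴴ *
        (hA.eigenvectorUnitary : Matrix n n ℂ)) j i) := by
  rw [hA.cfc_eq_mul_diagonal_mul, hB.cfc_eq_mul_diagonal_mul]
  set U := (hA.eigenvectorUnitary : Matrix n n ℂ)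
  set V := (hB.eigenvectorUnitary : Matrix n n ℂ)
  set F := diagonal (fun i => (f (hB.eigenvalues i) : ℂ))
  set G := diagonal (fun i => (g (hA.eigenvalues i) : ℂ))
  have h : trace (V * F * Vᴴ * (U * G * Uᴴ)) = trace (F * ((Vᴴ * U) * G * (Vᴴ * U)ᴴ)) := by
    rw [conjTranspose_mul, conjTranspose_conjTranspose, mul_assoc V, mul_assoc V, trace_mul_comm V]
    simp only [mul_assoc]
  rw [h]
  simp only [trace, diag_apply, F, G, diagonal_mul, Complex.re_sum]
  refine Finset.sum_congr rfl fun j _ => ?_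
  rw [mul_apply, Finset.mul_sum, Complex.re_sum]
  refine Finset.sum_congr rfl fun i _ => ?_
  rw [mul_diagonal, conjTranspose_apply, mul_right_comm _ _ (star _), Complex.star_def,
    Complex.mul_conj]
  norm_cast
  ring

/-- **Klein's inequality** for `x ↦ x * log x`, between positive definite matrices of equal
trace. -/
theorem PosDef.re_trace_mul_log_le {A B : Matrix n n ℂ} (hA : A.PosDef) (hB : B.PosDef)
    (htr : A.trace = B.trace) :
    (trace (B * matLog A)).re ≤ (trace (B * matLog B)).re := by
  have hid (C : Matrix n n ℂ) (hC : C.IsHermitian) : cfc (fun x : ℝ => x) C = C :=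
    cfc_id' ℝ C hC.isSelfAdjoint
  have hone (C : Matrix n n ℂ) (hC : C.IsHermitian) : cfc (fun _ : ℝ => (1 : ℝ)) C = 1 :=
    cfc_const_one ℝ C hC.isSelfAdjoint
  have hcont (C : Matrix n n ℂ) (hC : C.PosDef) : ContinuousOn Real.log (spectrum ℝ C) := by
    rw [continuousOn_iff_continuous_domRestrict]
    have := (finite_real_spectrum (A := C)).to_subtype
    fun_prop
  have hBB : B * matLog B = cfc (fun x => x * Real.log x) B * cfc (fun _ => (1 : ℝ)) A := by
    rw [hone A hA.1, mul_one, cfc_mul (fun x => x) Real.log B (by fun_prop) (hcont B hB),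
      hid B hB.1, matLog]
  have hBA : B * matLog A = cfc (fun x : ℝ => x) B * cfc Real.log A := by rw [hid B hB.1, matLog]
  have hA1 : A = cfc (fun _ => (1 : ℝ)) B * cfc (fun x : ℝ => x) A := by
    rw [hid A hA.1, hone B hB.1, one_mul]
  have hB1 : B = cfc (fun x : ℝ => x) B * cfc (fun _ => (1 : ℝ)) A := by
    rw [hid B hB.1, hone A hA.1, mul_one]
  have hre : (trace A).re = (trace B).re := by rw [htr]
  rw [congrArg trace hA1, congrArg trace hB1, hA.1.trace_cfc_mul_cfc hB.1,
    hA.1.trace_cfc_mul_cfc hB.1] at hre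
  rw [hBB, hBA, hA.1.trace_cfc_mul_cfc hB.1, hA.1.trace_cfc_mul_cfc hB.1, ← sub_nonneg]
  refine le_of_le_of_eq ?_ (add_eq_left.mpr (sub_eq_zero.mpr hre))
  simp only [← Finset.sum_sub_distrib, ← Finset.sum_add_distrib]
  refine Finset.sum_nonneg fun j _ => ?_
  refine Finset.sum_nonneg fun i _ => ?_
  have ha := hA.eigenvalues_pos i
  have hb := hB.eigenvalues_pos j
  set a := hA.1.eigenvalues i
  set b := hB.1.eigenvalues j
  set w := Complex.normSq (((hB.1.eigenvectorUnitary : Matrix n n ℂ)ᴴ *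
        (hA.1.eigenvectorUnitary : Matrix n n ℂ)) j i)
  have hw : 0 ≤ w := Complex.normSq_nonneg _
  have hlog : b * (Real.log a - Real.log b) ≤ a - b := by
    have := Real.log_le_sub_one_of_pos (div_pos ha hb)
    rw [Real.log_div ha.ne' hb.ne'] at this
    calc b * (Real.log a - Real.log b) ≤ b * (a / b - 1) := by gcongr
      _ = a - b := by field_simp
  nlinarith [mul_nonneg hw (sub_nonneg.mpr hlog)]

theorem trNorm_eq_sum (X : Matrix n n ℂ) :
    trNorm X = ∑ j, Real.sqrt ((isHermitian_conjTranspose_mul_self X).eigenvalues j) := by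
  have h := isHermitian_conjTranspose_mul_self X
  rw [trNorm, h.cfc_eq_mul_diagonal_mul, trace_mul_comm, ← mul_assoc,
    h.conjTranspose_eigenvectorUnitary_mul, one_mul, trace_diagonal, Complex.re_sum]
  rfl

theorem sum_norm_sq_col {m : Type*} [Fintype m] (M : Matrix m m ℂ) (j : m) : ∑ k, ‖M k j‖ ^ 2 = ((Mᴴ * M) j j).re := by
  rw [mul_apply, Complex.re_sum]
  refine Finset.sum_congr rfl fun k _ => ?_
  rw [conjTranspose_apply, Complex.star_def, ← Complex.normSq_eq_conj_mul_self, Complex.ofReal_re,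
    Complex.normSq_eq_norm_sq]

/-- The Hölder inequality between the trace norm and the operator norm. -/
theorem abs_re_trace_mul_le_trNorm_mul_opNorm (X : Matrix n n ℂ) {L : Matrix n n ℂ}
    (hL : L.IsHermitian) :
    |(trace (X * L)).re| ≤ trNorm X * opNorm hL := by
  have hX := isHermitian_conjTranspose_mul_self X
  rw [trNorm_eq_sum, Finset.sum_mul]
  set U := (hL.eigenvectorUnitary : Matrix n n ℂ) with hU
  set V := (hX.eigenvectorUnitary : Matrix n n ℂ) with hV
  have hUU : U * Uᴴ = 1 := hL.eigenvectorUnitary_mul_conjTranspose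
  have hVV : V * Vᴴ = 1 := hX.eigenvectorUnitary_mul_conjTranspose
  have hVV' : Vᴴ * V = 1 := hX.conjTranspose_eigenvectorUnitary_mul
  set D := diagonal (fun i => (hL.eigenvalues i : ℂ)) with hD
  have htrace : trace (X * L) = trace ((Uᴴ * V)ᴴ * (D * (Uᴴ * X * V))) := by
    conv_lhs => rw [hL.eq_mul_diagonal_mul, ← mul_one X, ← hVV]
    rw [← hU, ← hD, conjTranspose_mul, conjTranspose_conjTranspose,
      show X * (V * Vᴴ) * (U * D * Uᴴ) = (X * V) * (Vᴴ * U * (D * Uᴴ)) by simp only [mul_assoc],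
      trace_mul_comm (X * V)]
    simp only [mul_assoc]
  have hP (j : n) : ∑ k, ‖(Uᴴ * V) k j‖ ^ 2 = 1 := by
    rw [sum_norm_sq_col, conjTranspose_mul, conjTranspose_conjTranspose,
      show Vᴴ * U * (Uᴴ * V) = Vᴴ * (U * Uᴴ) * V by simp only [mul_assoc], hUU, mul_one, hVV',
      one_apply_eq, Complex.one_re]
  have hY (j : n) : ∑ k, ‖(Uᴴ * X * V) k j‖ ^ 2 = hX.eigenvalues j := by
    rw [sum_norm_sq_col, conjTranspose_mul, conjTranspose_mul, conjTranspose_conjTranspose,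
      show Vᴴ * (Xᴴ * U) * (Uᴴ * X * V) = Vᴴ * (Xᴴ * (U * Uᴴ) * X) * V by simp only [mul_assoc],
      hUU, mul_one]
    conv_lhs => rw [hX.eq_mul_diagonal_mul]
    rw [← hV, ← mul_assoc, ← mul_assoc, hVV', one_mul, mul_assoc, hVV', mul_one, diagonal_apply_eq,
      Complex.ofReal_re]
  rw [htrace]
  refine (Complex.abs_re_le_norm _).trans ((norm_sum_le _ _).trans ?_)
  refine Finset.sum_le_sum fun j _ => ?_
  rw [diag_apply, mul_apply]
  refine (norm_sum_le _ _).trans ?_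
  calc ∑ k, ‖(Uᴴ * V)ᴴ j k * (D * (Uᴴ * X * V)) k j‖
      ≤ ∑ k, opNorm hL * (‖(Uᴴ * V) k j‖ * ‖(Uᴴ * X * V) k j‖) := by
        refine Finset.sum_le_sum fun k _ => ?_
        rw [hD, diagonal_mul, conjTranspose_apply, norm_mul, norm_mul, norm_star,
          Complex.norm_real, Real.norm_eq_abs, mul_left_comm]
        gcongr
        exact le_ciSup (f := fun i => |hL.eigenvalues i|) (Set.finite_range _).bddAbove k
    _ ≤ opNorm hL * (Real.sqrt (∑ k, ‖(Uᴴ * V) k j‖ ^ 2) *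
          Real.sqrt (∑ k, ‖(Uᴴ * X * V) k j‖ ^ 2)) := by
        rw [← Finset.mul_sum]
        refine mul_le_mul_of_nonneg_left (Real.sum_mul_le_sqrt_mul_sqrt _ _ _) ?_
        exact Real.iSup_nonneg fun i => abs_nonneg _
    _ = Real.sqrt (hX.eigenvalues j) * opNorm hL := by
        rw [hP, hY, Real.sqrt_one, one_mul, mul_comm]

section Continuity

open scoped Matrix.Norms.L2Operator

theorem continuous_matLog {X : Type*} [TopologicalSpace X] {ρ : X → Matrix n n ℂ}
    (hρ : Continuous ρ) (hpd : ∀ x, (ρ x).PosDef) : Continuous fun x => matLog (ρ x) := by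
  refine Continuous.cfc_of_mem_nhdsSet (s := {0}ᶜ) Real.log ?_ hρ
    (fun x => (hpd x).1.isSelfAdjoint) Real.continuousOn_log
  refine isOpen_compl_singleton.mem_nhdsSet.mpr (Set.iUnion_subset fun x y hy => ?_)
  rw [(hpd x).1.spectrum_real_eq_range_eigenvalues] at hy
  obtain ⟨i, rfl⟩ := hy
  exact ((hpd x).eigenvalues_pos i).ne'

end Continuity

theorem re_trace_mul_eq_sum {m : Type*} [Fintype m] (A B : Matrix m m ℂ) :
    (trace (A * B)).re = ∑ i, ∑ j, (A i j * B j i).re := by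
  simp only [trace, diag_apply, mul_apply, Complex.re_sum]

theorem hasDerivAt_re_trace_mul_matLog {ρ : ℝ → Matrix n n ℂ} {ρ' : Matrix n n ℂ} {t : ℝ}
    (hρ : Continuous ρ) (hpd : ∀ t, (ρ t).PosDef) (htr : ∀ t, (ρ t).trace = 1)
    (hd : ∀ i j, HasDerivAt (fun s => ρ s i j) (ρ' i j) t) :
    HasDerivAt (fun s => (trace (ρ s * matLog (ρ s))).re) (trace (ρ' * matLog (ρ t))).re t := by
  have hfix : HasDerivAt (fun s => (trace (ρ s * matLog (ρ t))).re)
      (trace (ρ' * matLog (ρ t))).re t := by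
    simp only [re_trace_mul_eq_sum]
    refine HasDerivAt.fun_sum fun i _ => HasDerivAt.fun_sum fun j _ => ?_
    exact Complex.reCLM.hasFDerivAt.comp_hasDerivAt t ((hd i j).mul_const _)
  have hrem : HasDerivAt (fun s => (trace (ρ s * matLog (ρ s))).re -
      (trace (ρ s * matLog (ρ t))).re) 0 t := by
    have hlittle : (fun s => (trace ((ρ s - ρ t) * (matLog (ρ s) - matLog (ρ t)))).re)
        =o[nhds t] fun s => s - t := by
      simp only [re_trace_mul_eq_sum]
      refine Asymptotics.IsLittleO.fun_sum fun i _ => ?_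
      refine Asymptotics.IsLittleO.fun_sum fun j _ => ?_
      refine (Asymptotics.isBigO_of_le (f := fun s => ((ρ s - ρ t) i j *
        (matLog (ρ s) - matLog (ρ t)) j i).re) (g := fun s => (ρ s - ρ t) i j *
        (matLog (ρ s) - matLog (ρ t)) j i) _ fun s => Complex.abs_re_le_norm _).trans_isLittleO ?_
      have h1 : (fun s => (ρ s - ρ t) i j) =O[nhds t] fun s => s - t := (hd i j).isBigO_sub
      have h2 : (fun s => (matLog (ρ s) - matLog (ρ t)) j i) =o[nhds t] fun _ => (1 : ℝ) := by
        rw [Asymptotics.isLittleO_one_iff]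
        have : Continuous fun s => (matLog (ρ s) - matLog (ρ t)) j i :=
          ((continuous_matLog hρ hpd).sub continuous_const).matrix_elem j i
        simpa using this.tendsto t
      simpa using h1.mul_isLittleO h2
    rw [hasDerivAt_iff_isLittleO]
    refine (Asymptotics.isBigO_of_le _ fun s => ?_).trans_isLittleO hlittle
    have h1 := (hpd t).re_trace_mul_log_le (hpd s) ((htr t).trans (htr s).symm)
    have h2 := (hpd s).re_trace_mul_log_le (hpd t) ((htr s).trans (htr t).symm)
    simp only [sub_self, smul_zero, sub_zero]
    rw [Real.norm_of_nonneg (sub_nonneg.mpr h1)]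
    refine le_trans ?_ (le_abs_self _)
    simp only [sub_mul, mul_sub, trace_sub, Complex.sub_re]
    linarith
  simpa using hrem.fun_add hfix

end Matrix

theorem sq_intervalIntegral_le {h : ℝ → ℝ} (hh : Continuous h) {T : ℝ} (hT : 0 < T) :
    (∫ t in (0 : ℝ)..T, h t) ^ 2 ≤ T * ∫ t in (0 : ℝ)..T, h t ^ 2 := by
  set c := (∫ t in (0 : ℝ)..T, h t) / T with hc
  have hI : ∫ t in (0 : ℝ)..T, h t = c * T := by rw [hc]; field_simp
  have hnn : 0 ≤ ∫ t in (0 : ℝ)..T, (h t - c) ^ 2 :=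
    intervalIntegral.integral_nonneg hT.le fun t _ => sq_nonneg _
  have hexp : ∫ t in (0 : ℝ)..T, (h t - c) ^ 2 =
      (∫ t in (0 : ℝ)..T, h t ^ 2) - 2 * c * (∫ t in (0 : ℝ)..T, h t) + c ^ 2 * T := by
    have h1 : IntervalIntegrable (fun t => h t ^ 2) volume 0 T :=
      (hh.pow 2).intervalIntegrable _ _
    have h2 : IntervalIntegrable (fun t => 2 * c * h t) volume 0 T :=
      (continuous_const.mul hh).intervalIntegrable _ _
    have h3 : IntervalIntegrable (fun _ : ℝ => c ^ 2) volume 0 T := intervalIntegrable_const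
    rw [← intervalIntegral.integral_const_mul, ← intervalIntegral.integral_sub h1 h2]
    rw [show c ^ 2 * T = ∫ _ in (0 : ℝ)..T, c ^ 2 by simp [mul_comm],
      ← intervalIntegral.integral_add (h1.sub h2) h3]
    congr 1 with t
    ring
  rw [hexp, hI] at hnn
  rw [hI]
  nlinarith [mul_nonneg hT.le hnn]

theorem info_action_speed_limit {n : Type*} [Fintype n] [DecidableEq n]
    (ρ ρ' : ℝ → Matrix n n ℂ) (T : ℝ) (hT : 0 < T)
    (hpd : ∀ t, (ρ t).PosDef) (htr : ∀ t, (ρ t).trace = 1)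
    (hd : ∀ t i j, HasDerivAt (fun s => ρ s i j) (ρ' t i j) t)
    (hc : ∀ i j, Continuous fun t => ρ' t i j)
    (hL : ∀ t, (matLog (ρ t)).IsHermitian)
    (hpos : 0 < ∫ t in (0:ℝ)..T, (trNorm (ρ' t) * opNorm (hL t)) ^ 2) :
    |maxInfo (ρ T) - maxInfo (ρ 0)| ^ 2 /
      (∫ t in (0:ℝ)..T, (trNorm (ρ' t) * opNorm (hL t)) ^ 2) ≤ T := by
  set F : ℝ → ℝ := fun t => (Matrix.trace (ρ t * matLog (ρ t))).re
  set h : ℝ → ℝ := fun t => (Matrix.trace (ρ' t * matLog (ρ t))).re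
  have hρ : Continuous ρ := continuous_matrix fun i j =>
    continuous_iff_continuousAt.mpr fun t => (hd t i j).continuousAt
  have hh : Continuous h :=
    Complex.continuous_re.comp
      ((continuous_matrix hc).matrix_mul (Matrix.continuous_matLog hρ hpd)).matrix_trace
  have hF : ∫ t in (0 : ℝ)..T, h t = F T - F 0 :=
    intervalIntegral.integral_eq_sub_of_hasDerivAt
      (fun t _ => Matrix.hasDerivAt_re_trace_mul_matLog hρ hpd htr (hd t))
      (hh.intervalIntegrable _ _)
  have hI : maxInfo (ρ T) - maxInfo (ρ 0) = F T - F 0 := by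
    simp only [maxInfo, vnEntropy, F]
    ring
  have hle : ∫ t in (0 : ℝ)..T, h t ^ 2 ≤
      ∫ t in (0 : ℝ)..T, (trNorm (ρ' t) * opNorm (hL t)) ^ 2 := by
    refine intervalIntegral.integral_mono_on hT.le ((hh.pow 2).intervalIntegrable _ _)
      (intervalIntegral.intervalIntegrable_of_integral_ne_zero hpos.ne') fun t _ => ?_
    rw [← sq_abs (h t)]
    gcongr
    exact Matrix.abs_re_trace_mul_le_trNorm_mul_opNorm (ρ' t) (hL t)
  rw [div_le_iff₀ hpos, sq_abs, hI, ← hF]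
  exact (sq_intervalIntegral_le hh hT).trans (mul_le_mul_of_nonneg_left hle hT.le)
end
end
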